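/- Let n ≥ 2 and let Ω be a bounded (α, β)-John domain in ℝⁿ. If 0 < δ ≤ n and δ/n < p < δ, then there exists a constant c depending only on n, δ, p, α, and β such that inf_{b ∈ ℝ} ( ∫_Ω |u(x) − b|^{δp/(δ−p)} dH^δ_∞ )^{(δ−p)/(δp)} ≤ c ( ∫_Ω |∇u(x)|^p dH^δ_∞ )^{1/p} for all u ∈ C¹(Ω). -/

import Mathlib

open MeasureTheory Metric Set Bornology
open scoped ENNReal NNReal

/-- The `δ`-dimensional Hausdorff content of a set `E ⊆ ℝⁿ`, defined as the infimum of
`∑ᵢ rᵢ^δ` over all countable coverings of `E` by open balls `B(xᵢ, rᵢ)`. -/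
noncomputable def hContent (n : ℕ) (δ : ℝ) (E : Set (EuclideanSpace ℝ (Fin n))) : ℝ≥0∞ :=
  ⨅ (x : ℕ → EuclideanSpace ℝ (Fin n)) (r : ℕ → ℝ≥0)
    (_ : E ⊆ ⋃ i, Metric.ball (x i) (r i)), ∑' i, (r i : ℝ≥0∞) ^ δ

/-- The `δ`-dimensional Hausdorff measure of `E ⊆ ℝⁿ`, obtained from coverings by open balls of
radii at most `ρ`, in the limit `ρ → 0⁺` (equivalently: the supremum over `ρ > 0`, since the
infima increase as `ρ` decreases). -/
noncomputable def hMeasure (n : ℕ) (δ : ℝ) (E : Set (EuclideanSpace ℝ (Fin n))) : ℝ≥0∞ :=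
  ⨆ (ρ : ℝ≥0) (_ : 0 < ρ),
    ⨅ (x : ℕ → EuclideanSpace ℝ (Fin n)) (r : ℕ → ℝ≥0)
      (_ : E ⊆ ⋃ i, Metric.ball (x i) (r i)) (_ : ∀ i, r i ≤ ρ), ∑' i, (r i : ℝ≥0∞) ^ δ

/-- The Choquet integral `∫_Ω f dH^δ_∞ = ∫₀^∞ H^δ_∞({x ∈ Ω : f x > t}) dt` of a
(nonnegative) real-valued function with respect to the Hausdorff content. -/
noncomputable def choquet (n : ℕ) (δ : ℝ) (Ω : Set (EuclideanSpace ℝ (Fin n)))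
    (f : EuclideanSpace ℝ (Fin n) → ℝ) : ℝ≥0∞ :=
  ∫⁻ t in Set.Ioi (0 : ℝ), hContent n δ {x ∈ Ω | t < f x}

/-- The Choquet integral of an `[0,∞]`-valued function with respect to the Hausdorff content. -/
noncomputable def echoquet (n : ℕ) (δ : ℝ) (Ω : Set (EuclideanSpace ℝ (Fin n)))
    (f : EuclideanSpace ℝ (Fin n) → ℝ≥0∞) : ℝ≥0∞ :=
  ∫⁻ t in Set.Ioi (0 : ℝ), hContent n δ {x ∈ Ω | ENNReal.ofReal t < f x}

/-- The centered fractional Hardy–Littlewood maximal function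
`M_κ f (x) = sup_{r>0} r^{κ-n} ∫_{B(x,r)} |f|`. -/
noncomputable def fracMaximal (n : ℕ) (κ : ℝ) (f : EuclideanSpace ℝ (Fin n) → ℝ)
    (x : EuclideanSpace ℝ (Fin n)) : ℝ≥0∞ :=
  ⨆ (r : ℝ) (_ : 0 < r),
    ENNReal.ofReal (r ^ (κ - n)) * ∫⁻ y in Metric.ball x r, ENNReal.ofReal |f y|

/-- The Riesz potential of order `1`: `I₁ f (x) = ∫_{ℝⁿ} |f y| / |x-y|^{n-1} dy`. -/
noncomputable def rieszPot (n : ℕ) (f : EuclideanSpace ℝ (Fin n) → ℝ)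
    (x : EuclideanSpace ℝ (Fin n)) : ℝ≥0∞ :=
  ∫⁻ y, ENNReal.ofReal |f y| / edist x y ^ ((n : ℝ) - 1)

/-- `Ω` is an `(α, β)`-John domain with John center `x₀`: every `x ∈ Ω` can be joined to `x₀`
by a rectifiable curve `γ : [0, L] → Ω` parametrized by arclength (hence `1`-Lipschitz) with
`γ 0 = x`, `γ L = x₀`, `L ≤ β` and `dist (γ t, ∂Ω) ≥ (α/β) t`. -/
def IsJohnDomainWithCenter (n : ℕ) (α β : ℝ) (Ω : Set (EuclideanSpace ℝ (Fin n)))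
    (x₀ : EuclideanSpace ℝ (Fin n)) : Prop :=
  x₀ ∈ Ω ∧ ∀ x ∈ Ω, ∃ L : ℝ, 0 ≤ L ∧ L ≤ β ∧ ∃ γ : ℝ → EuclideanSpace ℝ (Fin n),
    γ 0 = x ∧ γ L = x₀ ∧ (∀ t ∈ Set.Icc 0 L, γ t ∈ Ω) ∧
    LipschitzOnWith 1 γ (Set.Icc 0 L) ∧
    ∀ t ∈ Set.Icc 0 L, α / β * t ≤ Metric.infDist (γ t) (frontier Ω)

/-- `Ω` is an `(α, β)`-John domain. -/
def IsJohnDomain (n : ℕ) (α β : ℝ) (Ω : Set (EuclideanSpace ℝ (Fin n))) : Prop :=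
  ∃ x₀, IsJohnDomainWithCenter n α β Ω x₀

/-- The points around which some ball has scaled average of `g` larger than `t`. -/
def largeAverageSet (n : ℕ) (g : EuclideanSpace ℝ (Fin n) → ℝ≥0∞) (t : ℝ≥0∞) :
    Set (EuclideanSpace ℝ (Fin n)) :=
  {x | ∃ r : ℝ≥0, 0 < r ∧ t * (r : ℝ≥0∞) ^ n < ∫⁻ y in Metric.ball x r, g y}

lemma hContent_mono {n : ℕ} {δ : ℝ} {E F : Set (EuclideanSpace ℝ (Fin n))} (h : E ⊆ F) :
    hContent n δ E ≤ hContent n δ F :=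
  le_iInf fun x => le_iInf fun r => le_iInf fun hF =>
    iInf_le_of_le x (iInf_le_of_le r (iInf_le_of_le (h.trans hF) le_rfl))

lemma hContent_le_tsum {n : ℕ} {δ : ℝ} (hδ : 0 < δ) {ι : Type*} [Countable ι]
    {E : Set (EuclideanSpace ℝ (Fin n))} (x : ι → EuclideanSpace ℝ (Fin n)) (r : ι → ℝ≥0)
    (hE : E ⊆ ⋃ i, Metric.ball (x i) (r i)) :
    hContent n δ E ≤ ∑' i, (r i : ℝ≥0∞) ^ δ := by
  obtain ⟨e, he⟩ := Countable.exists_injective_nat ι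
  refine iInf_le_of_le (Function.extend e x 0) (iInf_le_of_le (Function.extend e r 0)
    (iInf_le_of_le ?_ ?_))
  · refine hE.trans (iUnion_subset fun i => ?_)
    refine subset_iUnion_of_subset (e i) ?_
    rw [he.extend_apply, he.extend_apply]
  · have h : Function.support (fun k => ((Function.extend e r 0 k : ℝ≥0) : ℝ≥0∞) ^ δ) ⊆
        range e := by
      intro k hk
      by_contra hne
      refine hk ?_
      simp only
      rw [Function.extend_apply' _ _ _ (by simpa using hne)]
      simp [hδ]
    rw [← he.tsum_eq h]
    simp [he.extend_apply]

lemma exists_cover_of_hContent_lt {n : ℕ} {δ : ℝ} {E : Set (EuclideanSpace ℝ (Fin n))}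
    {a : ℝ≥0∞} (h : hContent n δ E < a) :
    ∃ (x : ℕ → EuclideanSpace ℝ (Fin n)) (r : ℕ → ℝ≥0), E ⊆ (⋃ i, Metric.ball (x i) (r i)) ∧
      ∑' i, (r i : ℝ≥0∞) ^ δ < a := by
  simpa only [hContent, iInf_lt_iff, exists_prop] using h

lemma ENNReal.tsum_rpow_le_rpow_tsum {ι : Type*} (a : ι → ℝ≥0∞) {e : ℝ} (he : 1 ≤ e) :
    ∑' i, a i ^ e ≤ (∑' i, a i) ^ e := by
  have key : ∀ x : ℝ≥0∞, x ^ e = x * x ^ (e - 1) := fun x => by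
    conv_lhs => rw [show e = 1 + (e - 1) by ring]
    rw [ENNReal.rpow_add_of_nonneg _ _ zero_le_one (by linarith), ENNReal.rpow_one]
  rw [key (∑' i, a i), ← ENNReal.tsum_mul_right]
  refine ENNReal.tsum_le_tsum fun i => ?_
  rw [key]
  exact mul_le_mul_right (ENNReal.rpow_le_rpow (ENNReal.le_tsum i) (by linarith)) _

lemma volume_ball_nnreal {n : ℕ} (hn : 1 ≤ n) (x : EuclideanSpace ℝ (Fin n)) (r : ℝ≥0) :
    volume (Metric.ball x r) =
      (r : ℝ≥0∞) ^ n * volume (Metric.ball (0 : EuclideanSpace ℝ (Fin n)) 1) := by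
  have : Nonempty (Fin n) := ⟨⟨0, hn⟩⟩
  rw [Measure.addHaar_ball volume x r.coe_nonneg, finrank_euclideanSpace, Fintype.card_fin,
    ENNReal.ofReal_pow r.coe_nonneg, ENNReal.ofReal_coe_nnreal]

lemma volume_unitBall_ne_zero (n : ℕ) :
    volume (Metric.ball (0 : EuclideanSpace ℝ (Fin n)) 1) ≠ 0 :=
  (measure_ball_pos _ _ one_pos).ne'

lemma volume_unitBall_ne_top (n : ℕ) :
    volume (Metric.ball (0 : EuclideanSpace ℝ (Fin n)) 1) ≠ ⊤ :=
  measure_ball_lt_top.ne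

lemma rpow_rpow_div_natCast {n : ℕ} {δ : ℝ} (hδ : 0 < δ) (r : ℝ≥0∞) :
    (r ^ δ) ^ ((n : ℝ) / δ) = r ^ n := by
  rw [← ENNReal.rpow_mul, mul_div_cancel₀ _ hδ.ne', ENNReal.rpow_natCast]

lemma le_hContent_ball {n : ℕ} (hn : 1 ≤ n) {δ : ℝ} (hδ : 0 < δ) (hδn : δ ≤ n)
    (x : EuclideanSpace ℝ (Fin n)) (r : ℝ≥0) :
    (r : ℝ≥0∞) ^ δ ≤ hContent n δ (Metric.ball x r) := by
  refine le_iInf fun z => le_iInf fun s => le_iInf fun hs => ?_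
  have hpos : 0 < (n : ℝ) / δ := div_pos (by exact_mod_cast hn) hδ
  have h1 : (r : ℝ≥0∞) ^ n * volume (Metric.ball (0 : EuclideanSpace ℝ (Fin n)) 1) ≤
      (∑' i, (s i : ℝ≥0∞) ^ n) * volume (Metric.ball (0 : EuclideanSpace ℝ (Fin n)) 1) := by
    rw [← volume_ball_nnreal hn x, ← ENNReal.tsum_mul_right]
    refine (measure_mono hs).trans ((measure_iUnion_le _).trans_eq ?_)
    simp only [volume_ball_nnreal hn]
  have h2 := (ENNReal.mul_le_mul_iff_left (volume_unitBall_ne_zero n)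
    (volume_unitBall_ne_top n)).1 h1
  rw [← ENNReal.rpow_le_rpow_iff hpos, rpow_rpow_div_natCast hδ]
  refine h2.trans (le_trans (le_of_eq ?_)
    (ENNReal.tsum_rpow_le_rpow_tsum _ ((one_le_div hδ).2 hδn)))
  simp only [rpow_rpow_div_natCast hδ]

/-- Vitali covering bound for the content of the set where the `δ`-dimensional upper density of a
finite measure is large at some scale. -/
lemma hContent_large_density_le {n : ℕ} {δ : ℝ} (hδ : 0 < δ)
    (μ : Measure (EuclideanSpace ℝ (Fin n))) (hμ : μ univ ≠ ⊤) :
    hContent n δ {x | ∃ r : ℝ≥0, 0 < r ∧ (r : ℝ≥0∞) ^ δ < 2 * μ (Metric.ball x (2 * r))} ≤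
      2 * 11 ^ δ * μ univ := by
  set G := {x | ∃ r : ℝ≥0, 0 < r ∧ (r : ℝ≥0∞) ^ δ < 2 * μ (Metric.ball x (2 * r))} with hG
  choose! r hr0 hr using fun x (hx : x ∈ G) => hx
  have hbd : ∃ R : ℝ, ∀ x ∈ G, ((2 * r x : ℝ≥0) : ℝ) ≤ R := by
    have htop : (2 * μ univ) ^ (1 / δ) ≠ ⊤ :=
      ENNReal.rpow_ne_top_of_nonneg (by positivity) (ENNReal.mul_ne_top (by simp) hμ)
    refine ⟨2 * ((2 * μ univ) ^ (1 / δ)).toReal, fun x hx => ?_⟩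
    have h1 : (r x : ℝ≥0∞) ≤ (2 * μ univ) ^ (1 / δ) := by
      rw [one_div, ← ENNReal.rpow_inv_le_iff (by positivity), inv_inv]
      exact (hr x hx).le.trans (by gcongr; exact subset_univ _)
    have h2 := ENNReal.toReal_mono htop h1
    simp only [ENNReal.coe_toReal] at h2
    push_cast
    linarith
  obtain ⟨R, hR⟩ := hbd
  obtain ⟨v, hvG, hdisj, hcov⟩ := Vitali.exists_disjoint_subfamily_covering_enlargement_closedBall
    G id (fun x => ((2 * r x : ℝ≥0) : ℝ)) R hR 5 (by norm_num)
  have hdisj' : v.PairwiseDisjoint fun x => Metric.ball x (2 * r x : ℝ) := by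
    intro a ha b hb hab
    refine (hdisj ha hb hab).mono ?_ ?_ <;> simpa using ball_subset_closedBall
  have hcount : v.Countable := hdisj'.countable_of_isOpen (fun _ _ => isOpen_ball) fun x hx =>
    ⟨x, mem_ball_self (by have := hr0 x (hvG hx); positivity)⟩
  have := hcount.to_subtype
  calc hContent n δ G ≤ ∑' x : v, ((11 * r x : ℝ≥0) : ℝ≥0∞) ^ δ := by
        refine hContent_le_tsum hδ (fun x : v => (x : EuclideanSpace ℝ (Fin n))) _ ?_
        intro x hx
        obtain ⟨y, hy, hxy⟩ := hcov x hx
        refine mem_iUnion.2 ⟨⟨y, hy⟩, ?_⟩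
        have h1 := hxy (mem_closedBall_self (by positivity))
        have h2 : (0 : ℝ) < r y := hr0 y (hvG hy)
        simp only [id, mem_closedBall] at h1
        rw [mem_ball]
        push_cast at h1 ⊢
        linarith
    _ ≤ ∑' x : v, 2 * 11 ^ δ * μ (Metric.ball x (2 * r x)) := by
        refine ENNReal.tsum_le_tsum fun x => ?_
        push_cast
        rw [ENNReal.mul_rpow_of_nonneg _ _ hδ.le, mul_comm 2, mul_assoc]
        gcongr
        exact (hr x (hvG x.2)).le
    _ = 2 * 11 ^ δ * ∑' x : v, μ (Metric.ball x (2 * r x)) := ENNReal.tsum_mul_left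
    _ ≤ 2 * 11 ^ δ * μ univ := by
        gcongr
        refine (tsum_meas_le_meas_iUnion_of_disjoint μ (fun _ => measurableSet_ball) ?_).trans
          (measure_mono (subset_univ _))
        intro a b hab
        exact hdisj' a.2 b.2 (fun h => hab (Subtype.ext h))

lemma tsum_mul_volume_inter_ball_le {n : ℕ} (hn : 1 ≤ n) {δ : ℝ} (hδ : 0 < δ) (hδn : δ ≤ n)
    {ι : Type*} [Countable ι] (a : ι → ℝ≥0∞) (ha : ∀ i, 1 ≤ a i)
    (c : ι → EuclideanSpace ℝ (Fin n)) (r : ι → ℝ≥0) (x : EuclideanSpace ℝ (Fin n))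
    (hx : ∀ R : ℝ≥0, 0 < R → 2 * Measure.sum (fun i => (a i ^ (δ / n) * (r i : ℝ≥0∞) ^ δ) •
      Measure.dirac (c i)) (Metric.ball x (2 * R)) ≤ (R : ℝ≥0∞) ^ δ) {R : ℝ≥0} (hR : 0 < R) :
    ∑' i, a i * volume (Metric.ball (c i) (r i) ∩ Metric.ball x R) ≤
      volume (Metric.ball (0 : EuclideanSpace ℝ (Fin n)) 1) * (R : ℝ≥0∞) ^ n := by
  set ω := volume (Metric.ball (0 : EuclideanSpace ℝ (Fin n)) 1) with hω
  set m : ι → ℝ≥0∞ := fun i => a i ^ (δ / n) * (r i : ℝ≥0∞) ^ δ with hm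
  have hn0 : (0 : ℝ) < n := by exact_mod_cast hn
  have hμ : ∀ ρ : ℝ≥0, Measure.sum (fun i => m i • Measure.dirac (c i)) (Metric.ball x (2 * ρ)) =
      ∑' i, m i * (Metric.ball x (2 * ρ)).indicator 1 (c i) := fun ρ => by
    rw [Measure.sum_apply _ measurableSet_ball]
    simp only [Measure.smul_apply, Measure.dirac_apply' _ measurableSet_ball, smul_eq_mul]
  have hmpow : ∀ i, m i ^ ((n : ℝ) / δ) = a i * (r i : ℝ≥0∞) ^ n := fun i => by
    rw [hm, ENNReal.mul_rpow_of_nonneg _ _ (by positivity), rpow_rpow_div_natCast hδ,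
      ← ENNReal.rpow_mul]
    rw [show δ / n * (n / δ) = 1 by field_simp, ENNReal.rpow_one]
  have key : ∀ i, a i * volume (Metric.ball (c i) (r i) ∩ Metric.ball x R) ≤
      ω * (m i * (Metric.ball x (2 * R)).indicator 1 (c i)) ^ ((n : ℝ) / δ) := by
    intro i
    rcases (Metric.ball (c i) (r i) ∩ Metric.ball x R).eq_empty_or_nonempty with he | ⟨z, hz1, hz2⟩
    · simp [he]
    have hdist : dist (c i) x < r i + R := by
      have h1 := dist_triangle (c i) z x
      rw [mem_ball] at hz1 hz2
      rw [dist_comm (c i) z] at h1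
      linarith
    have hri : r i ≤ R := by
      by_contra! hlt
      have hr0 : 0 < r i := hR.trans hlt
      have h1 := hx (r i) hr0
      have hmem : c i ∈ Metric.ball x (2 * r i) := by
        rw [mem_ball]
        have : (R : ℝ) < r i := by exact_mod_cast hlt
        linarith
      have h2 : (r i : ℝ≥0∞) ^ δ ≤ ∑' i', m i' * (Metric.ball x (2 * r i)).indicator 1 (c i') := by
        refine le_trans ?_ (ENNReal.le_tsum i)
        rw [indicator_of_mem hmem, Pi.one_apply, mul_one]
        exact le_mul_of_one_le_left' (ENNReal.one_le_rpow (ha i) (by positivity))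
      rw [hμ] at h1
      have h3 : 2 * (r i : ℝ≥0∞) ^ δ ≤ (r i : ℝ≥0∞) ^ δ := le_trans (by gcongr) h1
      have h4 : (r i : ℝ≥0∞) ^ δ < 2 * (r i : ℝ≥0∞) ^ δ := by
        have h5 : (r i : ℝ≥0∞) ^ δ ≠ 0 := (ENNReal.rpow_pos (by exact_mod_cast hr0) (by simp)).ne'
        have h6 : (r i : ℝ≥0∞) ^ δ ≠ ⊤ := ENNReal.rpow_ne_top_of_nonneg hδ.le (by simp)
        rw [two_mul]
        exact ENNReal.lt_add_right h6 h5
      exact absurd h3 (not_le.2 h4)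
    have hmem : c i ∈ Metric.ball x (2 * R) := by
      rw [mem_ball]
      have : (r i : ℝ) ≤ R := by exact_mod_cast hri
      linarith
    rw [indicator_of_mem hmem, Pi.one_apply, mul_one, hmpow, mul_left_comm, mul_comm ω,
      ← volume_ball_nnreal hn]
    gcongr
    exact inter_subset_left
  calc _ ≤ ∑' i, ω * (m i * (Metric.ball x (2 * R)).indicator 1 (c i)) ^ ((n : ℝ) / δ) :=
        ENNReal.tsum_le_tsum key
    _ = ω * ∑' i, (m i * (Metric.ball x (2 * R)).indicator 1 (c i)) ^ ((n : ℝ) / δ) :=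
        ENNReal.tsum_mul_left
    _ ≤ ω * ((R : ℝ≥0∞) ^ δ) ^ ((n : ℝ) / δ) := by
        gcongr
        refine (ENNReal.tsum_rpow_le_rpow_tsum _ ((one_le_div hδ).2 hδn)).trans ?_
        refine ENNReal.rpow_le_rpow ?_ (by positivity)
        rw [← hμ]
        exact le_trans (le_mul_of_one_le_left' (by norm_num)) (hx R hR)
    _ = ω * (R : ℝ≥0∞) ^ n := by rw [rpow_rpow_div_natCast hδ]

lemma le_add_tsum_dyadic_levels {s t : ℝ≥0∞} (hs : s ≠ ⊤) (ht : t ≠ 0) :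
    s ≤ t + ∑' k : ℕ, 2 ^ (k + 1) * t * {y : ℝ≥0∞ | 2 ^ k * t < y}.indicator 1 s := by
  have hex : ∃ m : ℕ, s ≤ 2 ^ m * t := by
    obtain ⟨m, hm⟩ := ENNReal.exists_nat_gt (ENNReal.div_ne_top hs ht)
    refine ⟨m, ?_⟩
    rcases eq_or_ne t ⊤ with rfl | ht'
    · simp
    rw [← ENNReal.div_le_iff ht ht']
    exact hm.le.trans (by exact_mod_cast Nat.lt_two_pow_self.le)
  classical
  have h := Nat.find_spec hex
  rcases hm : Nat.find hex with _ | k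
  · rw [hm] at h
    simp only [pow_zero, one_mul] at h
    exact h.trans le_self_add
  · rw [hm] at h
    have hk : 2 ^ k * t < s := not_le.1 (Nat.find_min hex (by omega))
    refine h.trans (le_trans ?_ le_add_self)
    refine le_trans ?_ (ENNReal.le_tsum k)
    rw [indicator_of_mem (by exact hk), Pi.one_apply, mul_one]

/-- Truncated weak type estimate of the maximal operator at the endpoint exponent `δ / n`. -/
lemma hContent_largeAverageSet_le {n : ℕ} (hn : 1 ≤ n) {δ : ℝ} (hδ : 0 < δ) (hδn : δ ≤ n)
    {g : EuclideanSpace ℝ (Fin n) → ℝ≥0∞} (hg : ∀ x, g x ≠ ⊤) {t : ℝ≥0∞} (ht : t ≠ 0) :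
    hContent n δ (largeAverageSet n g
        (3 * volume (Metric.ball (0 : EuclideanSpace ℝ (Fin n)) 1) * t)) ≤
      2 * 11 ^ δ * ∑' k : ℕ, ((2 : ℝ≥0∞) ^ k) ^ (δ / n) * hContent n δ {x | 2 ^ k * t < g x} := by
  set ω := volume (Metric.ball (0 : EuclideanSpace ℝ (Fin n)) 1) with hω
  have hn0 : (0 : ℝ) < n := by exact_mod_cast hn
  set w : ℕ → ℝ≥0∞ := fun k => ((2 : ℝ≥0∞) ^ k) ^ (δ / n) with hw
  set h : ℕ → ℝ≥0∞ := fun k => hContent n δ {x | 2 ^ k * t < g x} with hh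
  have hw0 : ∀ k, w k ≠ 0 := fun k => (ENNReal.rpow_pos (by positivity) (by simp)).ne'
  have hwt : ∀ k, w k ≠ ⊤ := fun k => ENNReal.rpow_ne_top_of_nonneg (by positivity) (by simp)
  rcases eq_or_ne (∑' k, w k * h k) ⊤ with htop | hfin
  · rw [htop, ENNReal.mul_top (by positivity)]
    exact le_top
  have hhfin : ∀ k, h k ≠ ⊤ := fun k hk => by
    refine ENNReal.ne_top_of_tsum_ne_top hfin k ?_
    rw [hk, ENNReal.mul_top (hw0 k)]
  have hct : (2 * 11 ^ δ : ℝ≥0∞) ≠ ⊤ :=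
    ENNReal.mul_ne_top (by simp) (ENNReal.rpow_ne_top_of_nonneg hδ.le (by simp))
  have main : ∀ ε : ℝ≥0∞, ε ≠ 0 → ε ≠ ⊤ →
      hContent n δ (largeAverageSet n g (3 * ω * t)) ≤ 2 * 11 ^ δ * (∑' k, w k * h k + ε) := by
    intro ε hε hεt
    obtain ⟨ε', hε'0, hε'⟩ := ENNReal.exists_pos_sum_of_countable' hε ℕ
    have hcov : ∀ k, ∃ (x : ℕ → EuclideanSpace ℝ (Fin n)) (r : ℕ → ℝ≥0),
        {x | 2 ^ k * t < g x} ⊆ (⋃ i, Metric.ball (x i) (r i)) ∧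
          ∑' i, (r i : ℝ≥0∞) ^ δ < h k + ε' k / w k := fun k =>
      exists_cover_of_hContent_lt
        (ENNReal.lt_add_right (hhfin k) (ENNReal.div_pos (hε'0 k).ne' (hwt k)).ne')
    choose c r hcr hsum using hcov
    set μ : Measure (EuclideanSpace ℝ (Fin n)) := Measure.sum (fun i : ℕ × ℕ =>
      (((2 : ℝ≥0∞) ^ i.1) ^ (δ / n) * (r i.1 i.2 : ℝ≥0∞) ^ δ) • Measure.dirac (c i.1 i.2)) with hμ
    have hμuniv : μ univ ≤ ∑' k, w k * h k + ε := by
      calc μ univ = ∑' k, w k * ∑' j, (r k j : ℝ≥0∞) ^ δ := by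
            rw [hμ, Measure.sum_apply _ MeasurableSet.univ]
            simp only [Measure.smul_apply, measure_univ, smul_eq_mul, mul_one]
            rw [ENNReal.tsum_prod (f := fun k j => ((2 : ℝ≥0∞) ^ k) ^ (δ / n) *
              (r k j : ℝ≥0∞) ^ δ)]
            simp only [ENNReal.tsum_mul_left, hw]
        _ ≤ ∑' k, (w k * h k + ε' k) := by
            refine ENNReal.tsum_le_tsum fun k => ?_
            refine (mul_le_mul_right (hsum k).le _).trans ?_
            rw [mul_add, ENNReal.mul_div_cancel (hw0 k) (hwt k)]
        _ ≤ _ := by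
            rw [ENNReal.tsum_add]
            gcongr
    refine le_trans (hContent_mono ?_) ((hContent_large_density_le hδ μ
      (ne_top_of_le_ne_top (ENNReal.add_ne_top.2 ⟨hfin, hεt⟩) hμuniv)).trans
      (mul_le_mul_right hμuniv _))
    intro x hx
    by_contra hxG
    simp only [mem_ofPred_eq, not_exists, not_and, not_lt] at hxG
    obtain ⟨R, hR, hlt⟩ := hx
    refine absurd hlt (not_lt.2 ?_)
    have hpt : ∀ y, g y ≤ t + ∑' i : ℕ × ℕ, 2 * t * (2 ^ i.1 *
        (Metric.ball (c i.1 i.2) (r i.1 i.2)).indicator 1 y) := by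
      intro y
      refine (le_add_tsum_dyadic_levels (hg y) ht).trans ?_
      gcongr
      rw [ENNReal.tsum_prod (f := fun k j => 2 * t * (2 ^ k *
        (Metric.ball (c k j) (r k j)).indicator 1 y))]
      refine ENNReal.tsum_le_tsum fun k => ?_
      by_cases hy : 2 ^ k * t < g y
      · obtain ⟨j, hj⟩ := mem_iUnion.1 (hcr k hy)
        refine le_trans (le_of_eq ?_) (ENNReal.le_tsum j)
        rw [indicator_of_mem (by exact hy), indicator_of_mem hj, pow_succ]
        simp only [Pi.one_apply, mul_one]
        ring
      · rw [indicator_of_notMem (by exact hy)]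
        simp
    calc ∫⁻ y in Metric.ball x R, g y
        ≤ ∫⁻ y in Metric.ball x R, (t + ∑' i : ℕ × ℕ, 2 * t * (2 ^ i.1 *
            (Metric.ball (c i.1 i.2) (r i.1 i.2)).indicator 1 y)) := lintegral_mono hpt
      _ = t * volume (Metric.ball x R) + 2 * t * ∑' i : ℕ × ℕ, 2 ^ i.1 *
            volume (Metric.ball (c i.1 i.2) (r i.1 i.2) ∩ Metric.ball x R) := by
          have hmeas : ∀ i : ℕ × ℕ, Measurable fun y =>
              (Metric.ball (c i.1 i.2) (r i.1 i.2)).indicator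
                (1 : EuclideanSpace ℝ (Fin n) → ℝ≥0∞) y :=
            fun i => measurable_one.indicator measurableSet_ball
          rw [lintegral_add_left measurable_const, setLIntegral_const, lintegral_tsum fun i =>
            (((hmeas i).const_mul _).const_mul _).aemeasurable, ← ENNReal.tsum_mul_left]
          congr 1
          refine tsum_congr fun i => ?_
          rw [lintegral_const_mul _ ((hmeas i).const_mul _), lintegral_const_mul _ (hmeas i),
            lintegral_indicator_one measurableSet_ball, Measure.restrict_apply measurableSet_ball]
      _ ≤ t * (R ^ n * ω) + 2 * t * (ω * R ^ n) := by
          rw [volume_ball_nnreal hn]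
          gcongr
          exact tsum_mul_volume_inter_ball_le hn hδ hδn (fun i : ℕ × ℕ => (2 : ℝ≥0∞) ^ i.1)
            (fun i => one_le_pow₀ (by norm_num)) (fun i => c i.1 i.2) (fun i => r i.1 i.2) x
            hxG hR
      _ = 3 * ω * t * R ^ n := by ring
  refine ENNReal.le_of_forall_pos_le_add fun ε hε _ => ?_
  have := main (ε / (2 * 11 ^ δ)) (ENNReal.div_pos (by simpa using hε.ne') hct).ne'
    (ENNReal.div_ne_top (by simp) (by positivity))
  rwa [mul_add, ENNReal.mul_div_cancel (by positivity) hct] at this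

lemma setLIntegral_Ioi_comp_mul_left {a : ℝ} (ha : 0 < a) (f : ℝ → ℝ≥0∞) :
    ∫⁻ τ in Ioi (0 : ℝ), f (a * τ) = ENNReal.ofReal a⁻¹ * ∫⁻ τ in Ioi (0 : ℝ), f τ := by
  have hpre : (fun τ => a * τ) ⁻¹' Ioi (0 : ℝ) = Ioi 0 := by
    ext τ
    simp [ha]
  have hemb : MeasurableEmbedding fun τ : ℝ => a * τ := measurableEmbedding_mulLeft₀ ha.ne'
  have h1 := hemb.lintegral_map (μ := volume.restrict (Ioi (0 : ℝ))) f
  rw [← h1]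
  conv_lhs => rw [← hpre]
  rw [← hemb.restrict_map, Real.map_volume_mul_left ha.ne', Measure.restrict_smul,
    lintegral_smul_measure, abs_of_pos (inv_pos.2 ha), smul_eq_mul]

/-- The `p`-th power Choquet integral `∫ g^p dH^δ_∞` of an `[0, ∞]`-valued function, written in
terms of the level sets of `g`. -/
noncomputable def choquetPow (n : ℕ) (δ p : ℝ) (g : EuclideanSpace ℝ (Fin n) → ℝ≥0∞) : ℝ≥0∞ :=
  ∫⁻ τ in Ioi (0 : ℝ), hContent n δ {x | ENNReal.ofReal (τ ^ (1 / p)) < g x}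

lemma antitone_hContent_level (n : ℕ) (δ : ℝ) (g : EuclideanSpace ℝ (Fin n) → ℝ≥0∞) :
    Antitone fun s : ℝ≥0∞ => hContent n δ {x | s < g x} :=
  fun _ _ h => hContent_mono fun _ hx => lt_of_le_of_lt h hx

/-- Chebyshev's inequality for the content. -/
lemma hContent_level_le {n : ℕ} {δ p : ℝ} (hp : 0 < p) (g : EuclideanSpace ℝ (Fin n) → ℝ≥0∞)
    {s : ℝ≥0∞} (hs0 : s ≠ 0) (hs : s ≠ ⊤) :
    hContent n δ {x | s < g x} ≤ (s ^ p)⁻¹ * choquetPow n δ p g := by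
  rw [mul_comm, ← div_eq_mul_inv, ENNReal.le_div_iff_mul_le
    (Or.inl (ENNReal.rpow_pos hs0.bot_lt hs).ne')
    (Or.inl (ENNReal.rpow_ne_top_of_nonneg hp.le hs))]
  lift s to ℝ≥0 using hs
  calc hContent n δ {x | (s : ℝ≥0∞) < g x} * (s : ℝ≥0∞) ^ p
      = ∫⁻ _ in Ioc (0 : ℝ) ((s : ℝ) ^ p), hContent n δ {x | (s : ℝ≥0∞) < g x} := by
        rw [setLIntegral_const, Real.volume_Ioc, sub_zero,
          ← ENNReal.ofReal_rpow_of_nonneg s.coe_nonneg hp.le, ENNReal.ofReal_coe_nnreal]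
    _ ≤ ∫⁻ τ in Ioc (0 : ℝ) ((s : ℝ) ^ p),
          hContent n δ {x | ENNReal.ofReal (τ ^ (1 / p)) < g x} := by
        refine setLIntegral_mono' measurableSet_Ioc fun τ hτ => antitone_hContent_level n δ g ?_
        rw [ENNReal.ofReal_le_iff_le_toReal ENNReal.coe_ne_top, ENNReal.coe_toReal]
        calc τ ^ (1 / p) ≤ ((s : ℝ) ^ p) ^ (1 / p) :=
              Real.rpow_le_rpow hτ.1.le hτ.2 (by positivity)
          _ = s := by rw [← Real.rpow_mul s.coe_nonneg, mul_one_div_cancel hp.ne', Real.rpow_one]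
    _ ≤ _ := lintegral_mono_set Ioc_subset_Ioi_self

/-- The constant in the strong type inequality of the maximal operator. -/
noncomputable def maximalConst (n : ℕ) (δ p : ℝ) : ℝ≥0∞ :=
  2 * 11 ^ δ * ∑' k : ℕ, ((2 : ℝ≥0∞) ^ k) ^ (δ / n) * (((2 : ℝ≥0∞) ^ k) ^ p)⁻¹

lemma maximalConst_ne_top {n : ℕ} {δ p : ℝ} (hδ : 0 < δ) (hp : δ / n < p) :
    maximalConst n δ p ≠ ⊤ := by
  refine ENNReal.mul_ne_top
    (ENNReal.mul_ne_top (by simp) (ENNReal.rpow_ne_top_of_nonneg hδ.le (by simp))) ?_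
  have h : ∀ k : ℕ, ((2 : ℝ≥0∞) ^ k) ^ (δ / n) * (((2 : ℝ≥0∞) ^ k) ^ p)⁻¹ =
      ((2 : ℝ≥0∞) ^ (δ / n - p)) ^ k := fun k => by
    rw [← ENNReal.rpow_neg, ← ENNReal.rpow_add _ _ (by positivity) (by simp),
      ← ENNReal.rpow_natCast, ← ENNReal.rpow_natCast, ← ENNReal.rpow_mul, ← ENNReal.rpow_mul,
      mul_comm, sub_eq_add_neg]
  simp only [h]
  rw [ENNReal.tsum_geometric]
  refine ENNReal.inv_ne_top.2 (tsub_pos_iff_lt.2 ?_).ne'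
  exact ENNReal.rpow_lt_one_of_one_lt_of_neg (by norm_num) (by linarith)

lemma maximalConst_ne_zero (n : ℕ) (δ p : ℝ) : maximalConst n δ p ≠ 0 := by
  have h : (11 : ℝ≥0∞) ^ δ ≠ 0 := (ENNReal.rpow_pos (by norm_num) (by simp)).ne'
  refine mul_ne_zero (mul_ne_zero (by simp) h) ?_
  refine (lt_of_lt_of_le ?_ (ENNReal.le_tsum 0)).ne'
  simp

/-- Strong type inequality of the maximal operator with respect to the content. -/
lemma lintegral_hContent_largeAverageSet_le {n : ℕ} (hn : 1 ≤ n) {δ p : ℝ} (hδ : 0 < δ)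
    (hδn : δ ≤ n) (hp : 0 < p) {g : EuclideanSpace ℝ (Fin n) → ℝ≥0∞} (hg : ∀ x, g x ≠ ⊤) :
    ∫⁻ τ in Ioi (0 : ℝ), hContent n δ (largeAverageSet n g
        (3 * volume (Metric.ball (0 : EuclideanSpace ℝ (Fin n)) 1) *
          ENNReal.ofReal (τ ^ (1 / p)))) ≤
      maximalConst n δ p * choquetPow n δ p g := by
  have hmeas : ∀ k : ℕ, Measurable fun τ : ℝ =>
      hContent n δ {x | 2 ^ k * ENNReal.ofReal (τ ^ (1 / p)) < g x} := fun k =>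
    (antitone_hContent_level n δ g).measurable.comp
      ((ENNReal.measurable_ofReal.comp (measurable_id.pow_const _)).const_mul _)
  calc _ ≤ ∫⁻ τ in Ioi (0 : ℝ), 2 * 11 ^ δ * ∑' k : ℕ, ((2 : ℝ≥0∞) ^ k) ^ (δ / n) *
          hContent n δ {x | 2 ^ k * ENNReal.ofReal (τ ^ (1 / p)) < g x} := by
        refine setLIntegral_mono' measurableSet_Ioi fun τ hτ =>
          hContent_largeAverageSet_le hn hδ hδn hg ?_
        simpa using Real.rpow_pos_of_pos hτ _
    _ = 2 * 11 ^ δ * ∑' k : ℕ, ((2 : ℝ≥0∞) ^ k) ^ (δ / n) * ∫⁻ τ in Ioi (0 : ℝ),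
          hContent n δ {x | 2 ^ k * ENNReal.ofReal (τ ^ (1 / p)) < g x} := by
        rw [lintegral_const_mul _ (Measurable.tsum fun k => (hmeas k).const_mul _),
          lintegral_tsum fun k => ((hmeas k).const_mul _).aemeasurable]
        simp only [lintegral_const_mul _ (hmeas _)]
    _ = maximalConst n δ p * choquetPow n δ p g := by
        rw [maximalConst, mul_assoc (2 * 11 ^ δ : ℝ≥0∞), ← ENNReal.tsum_mul_right]
        congr 1
        refine tsum_congr fun k => ?_
        rw [mul_assoc]
        congr 1
        have h2 : (0 : ℝ) < (2 ^ k) ^ p := by positivity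
        have h3 : ENNReal.ofReal ((2 ^ k) ^ p)⁻¹ = (((2 : ℝ≥0∞) ^ k) ^ p)⁻¹ := by
          rw [ENNReal.ofReal_inv_of_pos h2, ← ENNReal.ofReal_rpow_of_pos (by positivity),
            ENNReal.ofReal_pow (by norm_num)]
          simp
        rw [choquetPow, ← h3, ← setLIntegral_Ioi_comp_mul_left h2]
        refine setLIntegral_congr_fun measurableSet_Ioi fun τ hτ => ?_
        rw [Real.mul_rpow h2.le (le_of_lt hτ), ← Real.rpow_mul (by positivity),
          mul_one_div_cancel hp.ne', Real.rpow_one, ENNReal.ofReal_mul (by positivity),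
          ENNReal.ofReal_pow (by norm_num)]
        simp

lemma setLIntegral_ball_le {n : ℕ} (hn : 1 ≤ n) {δ p : ℝ} (hδ : 0 < δ)
    (hδn : δ ≤ n) (hp : 0 < p) {g : EuclideanSpace ℝ (Fin n) → ℝ≥0∞} (hg : ∀ x, g x ≠ ⊤)
    (x : EuclideanSpace ℝ (Fin n)) {r : ℝ≥0} (hr : 0 < r) :
    ∫⁻ y in Metric.ball x r, g y ≤
      3 * volume (Metric.ball (0 : EuclideanSpace ℝ (Fin n)) 1) * 2 ^ n * (r : ℝ≥0∞) ^ n *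
        (maximalConst n δ p * choquetPow n δ p g / (r : ℝ≥0∞) ^ δ) ^ (1 / p) := by
  set ω := volume (Metric.ball (0 : EuclideanSpace ℝ (Fin n)) 1) with hω
  set N := choquetPow n δ p g with hN
  have hr' : (r : ℝ≥0∞) ≠ 0 := by simpa using hr.ne'
  have hrn : (r : ℝ≥0∞) ^ δ ≠ 0 := (ENNReal.rpow_pos hr'.bot_lt (by simp)).ne'
  have hrt : (r : ℝ≥0∞) ^ δ ≠ ⊤ := ENNReal.rpow_ne_top_of_nonneg hδ.le (by simp)
  have hA0 : 3 * ω * 2 ^ n * (r : ℝ≥0∞) ^ n ≠ 0 :=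
    mul_ne_zero (mul_ne_zero (mul_ne_zero (by simp) (volume_unitBall_ne_zero n)) (by simp))
      (pow_ne_zero _ hr')
  have hAt : 3 * ω * 2 ^ n * (r : ℝ≥0∞) ^ n ≠ ⊤ :=
    ENNReal.mul_ne_top (ENNReal.mul_ne_top (ENNReal.mul_ne_top (by simp)
      (volume_unitBall_ne_top n)) (by simp)) (by simp)
  by_contra! hlt
  rw [mul_comm, ← ENNReal.lt_div_iff_mul_lt (Or.inl hA0) (Or.inl hAt)] at hlt
  obtain ⟨t, ht1, ht2⟩ := exists_between hlt
  have ht0 : t ≠ 0 := (bot_le.trans_lt ht1).ne'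
  have htt : t ≠ ⊤ := ht2.ne_top
  rw [ENNReal.lt_div_iff_mul_lt (Or.inl hA0) (Or.inl hAt)] at ht2
  have hsub : Metric.ball x r ⊆ largeAverageSet n g (3 * ω * t) := by
    intro y hy
    refine ⟨2 * r, by positivity, lt_of_eq_of_lt ?_ (ht2.trans_le (lintegral_mono_set ?_))⟩
    · push_cast
      ring
    · intro z hz
      rw [mem_ball] at hy hz ⊢
      push_cast
      have := dist_triangle_right z y x
      rw [dist_comm y x] at hy
      have := dist_triangle z x y
      linarith
  have h1 : (r : ℝ≥0∞) ^ δ ≤ maximalConst n δ p * ((t ^ p)⁻¹ * N) := by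
    refine (le_hContent_ball hn hδ hδn x r).trans ((hContent_mono hsub).trans
      ((hContent_largeAverageSet_le hn hδ hδn hg ht0).trans ?_))
    rw [maximalConst, mul_assoc (2 * 11 ^ δ : ℝ≥0∞), ← ENNReal.tsum_mul_right]
    refine mul_le_mul_right (ENNReal.tsum_le_tsum fun k => ?_) _
    rw [mul_assoc]
    refine mul_le_mul_right ((hContent_level_le hp g (mul_ne_zero (by simp) ht0)
      (ENNReal.mul_ne_top (by simp) htt)).trans_eq ?_) _
    rw [ENNReal.mul_rpow_of_nonneg _ _ hp.le, ENNReal.mul_inv (Or.inr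
      (ENNReal.rpow_ne_top_of_nonneg hp.le htt)) (Or.inl (ENNReal.rpow_ne_top_of_nonneg hp.le
      (by simp))), mul_assoc]
  have htp0 : t ^ p ≠ 0 := (ENNReal.rpow_pos ht0.bot_lt htt).ne'
  have htpt : t ^ p ≠ ⊤ := ENNReal.rpow_ne_top_of_nonneg hp.le htt
  have h2 : maximalConst n δ p * N / (r : ℝ≥0∞) ^ δ < t ^ p := by
    rw [one_div, ENNReal.rpow_inv_lt_iff hp] at ht1
    exact ht1
  rw [ENNReal.div_lt_iff (Or.inl hrn) (Or.inl hrt)] at h2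
  refine absurd h2 (not_lt.2 ?_)
  calc t ^ p * (r : ℝ≥0∞) ^ δ ≤ t ^ p * (maximalConst n δ p * ((t ^ p)⁻¹ * N)) := by gcongr
    _ = (t ^ p * (t ^ p)⁻¹) * (maximalConst n δ p * N) := by ring
    _ = _ := by rw [ENNReal.mul_inv_cancel htp0 htpt, one_mul]

/-- The norm of the gradient of `u` in `Ω`, extended by zero. -/
noncomputable def gradNorm {n : ℕ} (Ω : Set (EuclideanSpace ℝ (Fin n)))
    (u : EuclideanSpace ℝ (Fin n) → ℝ) : EuclideanSpace ℝ (Fin n) → ℝ≥0∞ :=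
  Ω.indicator fun x => ‖fderiv ℝ u x‖ₑ

lemma measurable_gradNorm {n : ℕ} {Ω : Set (EuclideanSpace ℝ (Fin n))} (hΩ : IsOpen Ω)
    (u : EuclideanSpace ℝ (Fin n) → ℝ) : Measurable (gradNorm Ω u) :=
  (measurable_fderiv ℝ u).enorm.indicator hΩ.measurableSet

lemma enorm_sub_le_lintegral_gradNorm {n : ℕ} {Ω : Set (EuclideanSpace ℝ (Fin n))}
    (hΩ : IsOpen Ω) {u : EuclideanSpace ℝ (Fin n) → ℝ} (hu : ContDiffOn ℝ 1 u Ω)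
    (z w : EuclideanSpace ℝ (Fin n)) (hzw : ∀ s ∈ Icc (0 : ℝ) 1, z + s • w ∈ Ω) :
    ‖u (z + w) - u z‖ₑ ≤ ‖w‖ₑ * ∫⁻ s in Icc (0 : ℝ) 1, gradNorm Ω u (z + s • w) := by
  have hφ : ContDiffOn ℝ 1 (fun s : ℝ => u (z + s • w)) (Icc 0 1) :=
    hu.comp (by fun_prop) hzw
  have h1 := enorm_sub_le_lintegral_deriv_of_contDiffOn_Icc hφ zero_le_one
  simp only [one_smul, zero_smul, add_zero] at h1
  refine h1.trans ?_
  have hm : Measurable fun s : ℝ => gradNorm Ω u (z + s • w) :=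
    (measurable_gradNorm hΩ u).comp (by fun_prop)
  rw [← lintegral_const_mul _ hm]
  refine setLIntegral_mono' measurableSet_Icc fun s hs => ?_
  have hd : DifferentiableAt ℝ u (z + s • w) :=
    (hu.contDiffAt (hΩ.mem_nhds (hzw s hs))).differentiableAt one_ne_zero
  have hl : HasDerivAt (fun s : ℝ => z + s • w) w s := by
    simpa using ((hasDerivAt_id s).smul_const w).const_add z
  have h2 : HasDerivAt (fun s : ℝ => u (z + s • w)) (fderiv ℝ u (z + s • w) w) s :=
    hd.hasFDerivAt.comp_hasDerivAt s hl
  rw [h2.deriv, gradNorm, indicator_of_mem (hzw s hs), mul_comm]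
  exact ContinuousLinearMap.le_opENorm _ _

lemma setLIntegral_unitBall_comp_affine {n : ℕ} (g : EuclideanSpace ℝ (Fin n) → ℝ≥0∞)
    (c : EuclideanSpace ℝ (Fin n)) {ρ : ℝ} (hρ : 0 < ρ) :
    ∫⁻ y in Metric.ball (0 : EuclideanSpace ℝ (Fin n)) 1, g (c + ρ • y) =
      (ENNReal.ofReal ρ ^ n)⁻¹ * ∫⁻ y in Metric.ball c ρ, g y := by
  have hpre : (fun y : EuclideanSpace ℝ (Fin n) => c + ρ • y) ⁻¹' Metric.ball c ρ =
      Metric.ball 0 1 := by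
    ext y
    simp [norm_smul, abs_of_pos hρ, hρ]
  have hemb1 : MeasurableEmbedding fun y : EuclideanSpace ℝ (Fin n) => ρ • y :=
    measurableEmbedding_const_smul₀ hρ.ne'
  have hemb2 : MeasurableEmbedding fun y : EuclideanSpace ℝ (Fin n) => c + y :=
    measurableEmbedding_addLeft c
  have hemb : MeasurableEmbedding fun y : EuclideanSpace ℝ (Fin n) => c + ρ • y :=
    hemb2.comp hemb1
  have hmap : Measure.map (fun y : EuclideanSpace ℝ (Fin n) => c + ρ • y) volume =
      (ENNReal.ofReal ρ ^ n)⁻¹ • volume := by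
    have h := Measure.map_map (μ := (volume : Measure (EuclideanSpace ℝ (Fin n))))
      hemb2.measurable hemb1.measurable
    rw [Measure.map_addHaar_smul _ hρ.ne', Measure.map_smul, map_add_left_eq_self] at h
    rw [show (fun y : EuclideanSpace ℝ (Fin n) => c + ρ • y) = (fun y => c + y) ∘ (fun y => ρ • y)
      from rfl, ← h, finrank_euclideanSpace, Fintype.card_fin, abs_of_pos (by positivity),
      ENNReal.ofReal_inv_of_pos (by positivity), ENNReal.ofReal_pow hρ.le]
  have h1 := hemb.lintegral_map (μ := volume.restrict (Metric.ball 0 1)) g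
  rw [← h1, ← hpre, ← hemb.restrict_map, hmap, Measure.restrict_smul, lintegral_smul_measure,
    smul_eq_mul]

/-- Comparison of `u` on two neighbouring balls of a John chain. -/
lemma lintegral_enorm_sub_chain_step_le {n : ℕ} {Ω : Set (EuclideanSpace ℝ (Fin n))}
    (hΩ : IsOpen Ω) {u : EuclideanSpace ℝ (Fin n) → ℝ} (hu : ContDiffOn ℝ 1 u Ω)
    {κ τ : ℝ} (hκ : 0 < κ) (hκ1 : κ ≤ 1) (hτ : 0 < τ) {P Q : EuclideanSpace ℝ (Fin n)}
    (hPQ : ‖Q - P‖ ≤ κ * τ / 4) (hP : Metric.ball P (κ * τ) ⊆ Ω) :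
    ∫⁻ y in Metric.ball (0 : EuclideanSpace ℝ (Fin n)) 1,
        ‖u (Q + (κ * ((1 - κ / 4) * τ) / 2) • y) - u (P + (κ * τ / 2) • y)‖ₑ ≤
      ENNReal.ofReal τ * ((ENNReal.ofReal (κ * τ / 4) ^ n)⁻¹ *
        ∫⁻ y in Metric.ball P (κ * τ), gradNorm Ω u y) := by
  have hκτ : 0 < κ * τ := mul_pos hκ hτ
  have hκκ : κ * (κ * τ) ≤ κ * τ := mul_le_of_le_one_left hκτ.le hκ1
  have hκτ' : κ * τ ≤ τ := mul_le_of_le_one_left hτ.le hκ1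
  set ρ : ℝ → ℝ := fun s => κ * τ / 2 - s * (κ * (κ * τ) / 8) with hρ
  set c : ℝ → EuclideanSpace ℝ (Fin n) := fun s => P + s • (Q - P) with hc
  have hρpos : ∀ s ∈ Icc (0 : ℝ) 1, κ * τ / 4 ≤ ρ s ∧ ρ s ≤ κ * τ / 2 := by
    intro s hs
    have h1 : s * (κ * (κ * τ) / 8) ≤ κ * (κ * τ) / 8 :=
      mul_le_of_le_one_left (by positivity) hs.2
    have h2 : 0 ≤ s * (κ * (κ * τ) / 8) := mul_nonneg hs.1 (by positivity)
    constructor <;> simp only [hρ] <;> linarith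
  have hcball : ∀ s ∈ Icc (0 : ℝ) 1, Metric.ball (c s) (ρ s) ⊆ Metric.ball P (κ * τ) := by
    intro s hs
    refine ball_subset_ball' ?_
    have h1 : dist (c s) P ≤ κ * τ / 4 := by
      rw [dist_eq_norm]
      simp only [hc, add_sub_cancel_left, norm_smul, Real.norm_eq_abs, abs_of_nonneg hs.1]
      exact (mul_le_of_le_one_left (norm_nonneg _) hs.2).trans hPQ
    linarith [(hρpos s hs).2]
  have hpt : ∀ y ∈ Metric.ball (0 : EuclideanSpace ℝ (Fin n)) 1,
      ‖u (Q + (κ * ((1 - κ / 4) * τ) / 2) • y) - u (P + (κ * τ / 2) • y)‖ₑ ≤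
        ENNReal.ofReal τ * ∫⁻ s in Icc (0 : ℝ) 1, gradNorm Ω u (c s + ρ s • y) := by
    intro y hy
    have hy1 : ‖y‖ < 1 := by simpa using hy
    set w := (Q - P) - (κ * (κ * τ) / 8) • y with hw
    have hcw : ∀ s : ℝ, (P + (κ * τ / 2) • y) + s • w = c s + ρ s • y := fun s => by
      simp only [hw, hc, hρ]
      module
    have hend : Q + (κ * ((1 - κ / 4) * τ) / 2) • y = (P + (κ * τ / 2) • y) + w := by
      simp only [hw]
      module
    rw [hend]
    refine (enorm_sub_le_lintegral_gradNorm hΩ hu _ w fun s hs => ?_).trans ?_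
    · rw [hcw]
      refine hP (hcball s hs ?_)
      have h0 : 0 < ρ s := by linarith [(hρpos s hs).1]
      simpa [norm_smul, abs_of_pos h0, h0] using hy1
    · simp only [hcw]
      gcongr
      rw [← ofReal_norm]
      refine ENNReal.ofReal_le_ofReal ((norm_sub_le _ _).trans ?_)
      rw [norm_smul, Real.norm_eq_abs, abs_of_pos (by positivity)]
      have : κ * (κ * τ) / 8 * ‖y‖ ≤ κ * (κ * τ) / 8 := mul_le_of_le_one_right (by positivity) hy1.le
      linarith
  calc _ ≤ ∫⁻ y in Metric.ball (0 : EuclideanSpace ℝ (Fin n)) 1,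
        ENNReal.ofReal τ * ∫⁻ s in Icc (0 : ℝ) 1, gradNorm Ω u (c s + ρ s • y) :=
        setLIntegral_mono' measurableSet_ball hpt
    _ = ENNReal.ofReal τ * ∫⁻ s in Icc (0 : ℝ) 1,
          ∫⁻ y in Metric.ball (0 : EuclideanSpace ℝ (Fin n)) 1, gradNorm Ω u (c s + ρ s • y) := by
        have hmeas : Measurable fun z : EuclideanSpace ℝ (Fin n) × ℝ =>
            gradNorm Ω u (c z.2 + ρ z.2 • z.1) :=
          (measurable_gradNorm hΩ u).comp (by simp only [hc, hρ]; fun_prop)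
        rw [lintegral_const_mul _ hmeas.lintegral_prod_right',
          lintegral_lintegral_swap hmeas.aemeasurable]
    _ ≤ ENNReal.ofReal τ * ∫⁻ s in Icc (0 : ℝ) 1, ((ENNReal.ofReal (κ * τ / 4) ^ n)⁻¹ *
          ∫⁻ y in Metric.ball P (κ * τ), gradNorm Ω u y) := by
        refine mul_le_mul_right (setLIntegral_mono' measurableSet_Icc fun s hs => ?_) _
        have h0 := hρpos s hs
        rw [setLIntegral_unitBall_comp_affine _ _ (by linarith)]
        gcongr
        · exact h0.1
        · exact hcball s hs
    _ = _ := by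
        rw [setLIntegral_const]
        simp

/-- Pointwise estimate along a John curve, with a geometric sequence of scales. -/
lemma lintegral_enorm_sub_john_chain_le {n : ℕ} {Ω : Set (EuclideanSpace ℝ (Fin n))}
    (hΩ : IsOpen Ω) {u : EuclideanSpace ℝ (Fin n) → ℝ} (hu : ContDiffOn ℝ 1 u Ω)
    {κ T : ℝ} (hκ : 0 < κ) (hκ1 : κ ≤ 1) (hT : 0 < T) {γ : ℝ → EuclideanSpace ℝ (Fin n)}
    (h0 : γ 0 ∈ Ω) (hγ : LipschitzOnWith 1 γ (Icc 0 T))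
    (hball : ∀ t ∈ Ioc 0 T, Metric.ball (γ t) (κ * t) ⊆ Ω) :
    ∫⁻ y in Metric.ball (0 : EuclideanSpace ℝ (Fin n)) 1,
        ‖u (γ T + (κ * T / 2) • y) - u (γ 0)‖ₑ ≤
      ∑' k : ℕ, ENNReal.ofReal ((1 - κ / 4) ^ k * T) *
        ((ENNReal.ofReal (κ * ((1 - κ / 4) ^ k * T) / 4) ^ n)⁻¹ *
          ∫⁻ y in Metric.ball (γ 0) (2 * ((1 - κ / 4) ^ k * T)), gradNorm Ω u y) := by
  set t : ℕ → ℝ := fun k => (1 - κ / 4) ^ k * T with ht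
  have hl0 : 0 < 1 - κ / 4 := by linarith
  have hl1 : 1 - κ / 4 < 1 := by linarith
  have ht0 : ∀ k, 0 < t k := fun k => by positivity
  have htT : ∀ k, t k ≤ T := fun k => mul_le_of_le_one_left hT.le (pow_le_one₀ hl0.le hl1.le)
  have htsucc : ∀ k, t (k + 1) = (1 - κ / 4) * t k := fun k => by simp only [ht, pow_succ]; ring
  have hdist : ∀ a ∈ Icc 0 T, ∀ b ∈ Icc 0 T, dist (γ a) (γ b) ≤ |a - b| := fun a ha b hb => by
    simpa [Real.dist_eq] using hγ.dist_le_mul a ha b hb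
  have hlim : Filter.Tendsto t Filter.atTop (nhds 0) := by
    simpa using (tendsto_pow_atTop_nhds_zero_of_lt_one hl0.le hl1).mul_const T
  have hdist0 : ∀ k, dist (γ (t k)) (γ 0) ≤ t k := fun k => by
    have := hdist (t k) ⟨(ht0 k).le, htT k⟩ 0 ⟨le_rfl, hT.le⟩
    rwa [sub_zero, abs_of_pos (ht0 k)] at this
  set f : ℕ → EuclideanSpace ℝ (Fin n) → ℝ := fun k y => u (γ (t k) + (κ * t k / 2) • y) with hf
  have hmem : ∀ k, ∀ y ∈ Metric.ball (0 : EuclideanSpace ℝ (Fin n)) 1,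
      γ (t k) + (κ * t k / 2) • y ∈ Ω := by
    intro k y hy
    refine hball (t k) ⟨ht0 k, htT k⟩ ?_
    have hy1 : ‖y‖ < 1 := by simpa using hy
    have hpos : 0 < κ * t k := mul_pos hκ (ht0 k)
    rw [mem_ball, dist_eq_norm, add_sub_cancel_left, norm_smul, Real.norm_eq_abs,
      abs_of_pos (by positivity)]
    nlinarith [norm_nonneg y]
  have hcont : ∀ k, ContinuousOn (f k) (Metric.ball 0 1) := fun k =>
    hu.continuousOn.comp (by fun_prop) (hmem k)
  have htend : ∀ y, Filter.Tendsto (fun k => f k y) Filter.atTop (nhds (u (γ 0))) := by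
    intro y
    have hcu : ContinuousAt u (γ 0) := hu.continuousOn.continuousAt (hΩ.mem_nhds h0)
    refine hcu.tendsto.comp ?_
    have h1 : Filter.Tendsto (fun k => γ (t k)) Filter.atTop (nhds (γ 0)) :=
      tendsto_iff_dist_tendsto_zero.2 (squeeze_zero (fun _ => dist_nonneg) hdist0 hlim)
    have h2 : Filter.Tendsto (fun k => (κ * t k / 2) • y) Filter.atTop (nhds 0) := by
      simpa using ((hlim.const_mul κ).div_const 2).smul_const y
    simpa using h1.add h2
  have ht00 : t 0 = T := by simp [ht]
  calc _ ≤ ∫⁻ y in Metric.ball (0 : EuclideanSpace ℝ (Fin n)) 1,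
          ∑' k, ‖f (k + 1) y - f k y‖ₑ := by
        refine lintegral_mono fun y => ?_
        have := edist_le_tsum_of_edist_le_of_tendsto₀ (fun k => ‖f (k + 1) y - f k y‖ₑ)
          (fun k => by rw [edist_comm, edist_eq_enorm_sub]) (htend y)
        simp only [hf, ht00, edist_eq_enorm_sub] at this
        exact this
    _ = ∑' k, ∫⁻ y in Metric.ball (0 : EuclideanSpace ℝ (Fin n)) 1, ‖f (k + 1) y - f k y‖ₑ :=
        lintegral_tsum fun k =>
          (((hcont (k + 1)).sub (hcont k)).aemeasurable measurableSet_ball).enorm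
    _ ≤ _ := by
        refine ENNReal.tsum_le_tsum fun k => ?_
        simp only [hf, htsucc]
        refine (lintegral_enorm_sub_chain_step_le hΩ hu hκ hκ1 (ht0 k) ?_
          (hball _ ⟨ht0 k, htT k⟩)).trans ?_
        · rw [← dist_eq_norm, ← htsucc]
          refine (hdist _ ⟨(ht0 _).le, htT _⟩ _ ⟨(ht0 k).le, htT k⟩).trans_eq ?_
          have hpos : 0 < κ * t k := mul_pos hκ (ht0 k)
          rw [htsucc, show (1 - κ / 4) * t k - t k = -(κ * t k / 4) by ring, abs_neg,
            abs_of_pos (by positivity)]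
        · gcongr
          refine ball_subset_ball' ?_
          have : κ * t k ≤ t k := mul_le_of_le_one_left (ht0 k).le hκ1
          linarith [hdist0 k]

lemma tsum_le_of_le_geometric_scales {l T e ρ : ℝ} (hl0 : 0 < l) (hl1 : l < 1) (hT : 0 < T)
    (he : 0 < e) (hρ : 0 < ρ) {M K : ℝ≥0∞} {a : ℕ → ℝ≥0∞}
    (hM : ∀ k, a k ≤ M * ENNReal.ofReal (l ^ k * T))
    (hK : ∀ k, a k ≤ K * ENNReal.ofReal ((l ^ k * T) ^ (-e))) :
    ∑' k, a k ≤ M * ENNReal.ofReal ρ * (1 - ENNReal.ofReal l)⁻¹ +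
      K * ENNReal.ofReal (ρ ^ (-e)) * (1 - ENNReal.ofReal (l ^ e))⁻¹ := by
  have hex : ∃ k : ℕ, l ^ k * T ≤ ρ := by
    obtain ⟨k, hk⟩ := exists_pow_lt_of_lt_one (div_pos hρ hT) hl1
    exact ⟨k, ((lt_div_iff₀ hT).1 hk).le⟩
  classical
  have hspec := Nat.find_spec hex
  have hmin : ∀ k < Nat.find hex, ρ < l ^ k * T := fun k hk => not_le.1 (Nat.find_min hex hk)
  set m := Nat.find hex
  rw [← ENNReal.summable.sum_add_tsum_nat_add' (k := m), add_comm]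
  refine add_le_add ?_ ?_
  · rw [← ENNReal.tsum_geometric, ← ENNReal.tsum_mul_left]
    refine ENNReal.tsum_le_tsum fun k => (hM _).trans ?_
    rw [mul_assoc, ← ENNReal.ofReal_pow hl0.le, ← ENNReal.ofReal_mul hρ.le]
    refine mul_le_mul_right (ENNReal.ofReal_le_ofReal ?_) _
    calc l ^ (k + m) * T = l ^ k * (l ^ m * T) := by ring
      _ ≤ l ^ k * ρ := by gcongr
      _ = ρ * l ^ k := mul_comm _ _
  · rw [← ENNReal.tsum_geometric, ← ENNReal.tsum_mul_left, ← Finset.sum_range_reflect]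
    refine le_trans (Finset.sum_le_sum fun j hj => ?_) (ENNReal.sum_le_tsum (Finset.range m))
    have hj' : j < m := Finset.mem_range.1 hj
    refine (hK _).trans ?_
    rw [mul_assoc, ← ENNReal.ofReal_pow (by positivity), ← ENNReal.ofReal_mul (by positivity)]
    gcongr
    have h1 : ρ * (l ^ j)⁻¹ ≤ l ^ (m - 1 - j) * T := by
      rw [← div_eq_mul_inv, div_le_iff₀ (by positivity)]
      have h2 := hmin (m - 1) (by omega)
      rw [show m - 1 = (m - 1 - j) + j by omega, pow_add] at h2
      linarith
    calc (l ^ (m - 1 - j) * T) ^ (-e) ≤ (ρ * (l ^ j)⁻¹) ^ (-e) :=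
          Real.rpow_le_rpow_of_nonpos (by positivity) h1 (by linarith)
      _ = ρ ^ (-e) * (l ^ e) ^ j := by
          rw [Real.mul_rpow hρ.le (by positivity), Real.rpow_neg (by positivity) (x := (l ^ j)⁻¹),
            Real.inv_rpow (by positivity), inv_inv, ← Real.rpow_natCast, ← Real.rpow_natCast,
            ← Real.rpow_mul hl0.le, ← Real.rpow_mul hl0.le, mul_comm e]

lemma ball_subset_of_le_infDist_frontier {n : ℕ} (hn : 1 ≤ n)
    {Ω : Set (EuclideanSpace ℝ (Fin n))} (hb : IsBounded Ω)
    {z : EuclideanSpace ℝ (Fin n)} (hz : z ∈ Ω) {r : ℝ}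
    (hr : r ≤ infDist z (frontier Ω)) : Metric.ball z r ⊆ Ω := by
  have : Nonempty (Fin n) := ⟨⟨0, hn⟩⟩
  have hne : Ω ≠ univ := fun h => NormedSpace.unbounded_univ ℝ (EuclideanSpace ℝ (Fin n)) (h ▸ hb)
  obtain ⟨y, hy, hdist⟩ := exists_mem_frontier_infDist_compl_eq_dist hz hne
  refine (ball_subset_ball (hr.trans ?_)).trans (ball_infDist_compl_subset (x := z))
  rw [hdist]
  exact infDist_le_dist_of_mem hy

lemma infDist_frontier_pos {n : ℕ} (hn : 1 ≤ n) {Ω : Set (EuclideanSpace ℝ (Fin n))}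
    (hΩ : IsOpen Ω) (hb : IsBounded Ω) {z : EuclideanSpace ℝ (Fin n)} (hz : z ∈ Ω) :
    0 < infDist z (frontier Ω) := by
  have : Nonempty (Fin n) := ⟨⟨0, hn⟩⟩
  have hne : Ω ≠ univ := fun h => NormedSpace.unbounded_univ ℝ (EuclideanSpace ℝ (Fin n)) (h ▸ hb)
  obtain ⟨y, hy, -⟩ := exists_mem_frontier_infDist_compl_eq_dist hz hne
  refine (isClosed_frontier.notMem_iff_infDist_pos ⟨y, hy⟩).1 fun h => ?_
  rw [hΩ.frontier_eq] at h
  exact h.2 hz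

/-- In a John domain the John curves can be extended to a common parameter interval, along which
the carrots around the curves stay inside the domain. -/
lemma exists_john_curves {n : ℕ} (hn : 1 ≤ n) {α β : ℝ} (hα : 0 < α) (hαβ : α ≤ β)
    {Ω : Set (EuclideanSpace ℝ (Fin n))} (hΩ : IsOpen Ω) (hb : IsBounded Ω)
    (hJ : IsJohnDomain n α β Ω) :
    ∃ (x₀ : EuclideanSpace ℝ (Fin n)) (T : ℝ), 0 < T ∧ Metric.ball x₀ (α / β * T) ⊆ Ω ∧
      ∀ x ∈ Ω, ∃ γ : ℝ → EuclideanSpace ℝ (Fin n), γ 0 = x ∧ γ T = x₀ ∧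
        LipschitzOnWith 1 γ (Icc 0 T) ∧
        ∀ t ∈ Ioc 0 T, Metric.ball (γ t) (α / β * t) ⊆ Ω := by
  obtain ⟨x₀, hx₀, hJ⟩ := hJ
  have hκ : 0 < α / β := div_pos hα (hα.trans_le hαβ)
  have hd := infDist_frontier_pos hn hΩ hb hx₀
  set d := infDist x₀ (frontier Ω) with hd_def
  have hκT : α / β * (d / (α / β)) = d := mul_div_cancel₀ _ hκ.ne'
  refine ⟨x₀, d / (α / β), div_pos hd hκ, ?_, fun x hx => ?_⟩
  · rw [hκT]
    exact ball_subset_of_le_infDist_frontier hn hb hx₀ le_rfl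
  · obtain ⟨L, hL0, -, γ, hγ0, hγL, hγΩ, hlip, hdist⟩ := hJ x hx
    have hLT : L ≤ d / (α / β) := by
      rw [le_div_iff₀ hκ, mul_comm]
      have := hdist L ⟨hL0, le_rfl⟩
      rwa [hγL] at this
    refine ⟨fun t => γ (min t L), by simp [hL0, hγ0], by simp [hLT, hγL], ?_, fun t ht => ?_⟩
    · have h1 : LipschitzOnWith 1 (fun t : ℝ => min t L) (Icc 0 (d / (α / β))) :=
        (LipschitzWith.id.min_const L).lipschitzOnWith
      have h2 := hlip.comp h1 fun t ht => ⟨le_min ht.1 hL0, min_le_right _ _⟩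
      rwa [mul_one] at h2
    · have hmem : min t L ∈ Icc 0 L := ⟨le_min ht.1.le hL0, min_le_right _ _⟩
      refine ball_subset_of_le_infDist_frontier hn hb (hγΩ _ hmem) ?_
      rcases le_total t L with h | h
      · simpa [h] using hdist t ⟨ht.1.le, h⟩
      · simp only [min_eq_right h, hγL]
        refine le_trans ?_ hκT.le
        gcongr
        exact ht.2

lemma ofReal_mul_inv_mul_le {n : ℕ} {κ t : ℝ} (hκ : 0 < κ) (ht : 0 < t) {I B : ℝ≥0∞}
    (hI : I ≤ B * ENNReal.ofReal (2 * t) ^ n) :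
    ENNReal.ofReal t * ((ENNReal.ofReal (κ * t / 4) ^ n)⁻¹ * I) ≤
      ENNReal.ofReal (8 / κ) ^ n * (B * ENNReal.ofReal t) := by
  have h : ENNReal.ofReal (2 * t) = ENNReal.ofReal (8 / κ) * ENNReal.ofReal (κ * t / 4) := by
    rw [← ENNReal.ofReal_mul (by positivity)]
    congr 1
    field_simp
    norm_num
  have h0 : ENNReal.ofReal (κ * t / 4) ^ n ≠ 0 :=
    pow_ne_zero _ (ENNReal.ofReal_pos.2 (by positivity)).ne'
  have h1 : ENNReal.ofReal (κ * t / 4) ^ n ≠ ⊤ := ENNReal.pow_ne_top ENNReal.ofReal_ne_top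
  calc ENNReal.ofReal t * ((ENNReal.ofReal (κ * t / 4) ^ n)⁻¹ * I)
      ≤ ENNReal.ofReal t * ((ENNReal.ofReal (κ * t / 4) ^ n)⁻¹ *
          (B * ENNReal.ofReal (2 * t) ^ n)) := by gcongr
    _ = ENNReal.ofReal (8 / κ) ^ n * (B * ENNReal.ofReal t) *
          ((ENNReal.ofReal (κ * t / 4) ^ n)⁻¹ * ENNReal.ofReal (κ * t / 4) ^ n) := by
        rw [h, mul_pow]
        ring
    _ = _ := by rw [ENNReal.inv_mul_cancel h0 h1, mul_one]

lemma setLIntegral_ball_two_mul_le {n : ℕ} (hn : 1 ≤ n) {δ p : ℝ} (hδ : 0 < δ)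
    (hδn : δ ≤ n) (hp : 0 < p) {g : EuclideanSpace ℝ (Fin n) → ℝ≥0∞} (hg : ∀ x, g x ≠ ⊤)
    (x : EuclideanSpace ℝ (Fin n)) {t K : ℝ} (ht : 0 < t) (hK : 0 < K)
    (hN : choquetPow n δ p g ≤ ENNReal.ofReal (K ^ p)) :
    ∫⁻ y in Metric.ball x (2 * t), g y ≤
      3 * volume (Metric.ball (0 : EuclideanSpace ℝ (Fin n)) 1) * 2 ^ n *
        maximalConst n δ p ^ (1 / p) * (ENNReal.ofReal K * ENNReal.ofReal (t ^ (-(δ / p)))) *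
          ENNReal.ofReal (2 * t) ^ n := by
  have h := setLIntegral_ball_le hn hδ hδn hp hg x (r := (2 * t).toNNReal) (by simpa using ht)
  rw [Real.coe_toNNReal _ (by positivity)] at h
  change _ ≤ 3 * volume (Metric.ball (0 : EuclideanSpace ℝ (Fin n)) 1) * 2 ^ n *
    ENNReal.ofReal (2 * t) ^ n *
      (maximalConst n δ p * choquetPow n δ p g / ENNReal.ofReal (2 * t) ^ δ) ^ (1 / p) at h
  have h2 : (maximalConst n δ p * choquetPow n δ p g / ENNReal.ofReal (2 * t) ^ δ) ^ (1 / p) ≤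
      maximalConst n δ p ^ (1 / p) * (ENNReal.ofReal K * ENNReal.ofReal (t ^ (-(δ / p)))) := by
    calc (maximalConst n δ p * choquetPow n δ p g / ENNReal.ofReal (2 * t) ^ δ) ^ (1 / p)
        ≤ (maximalConst n δ p * ENNReal.ofReal (K ^ p) / ENNReal.ofReal t ^ δ) ^ (1 / p) := by
          gcongr
          linarith
      _ = (maximalConst n δ p * ENNReal.ofReal (K ^ p * (t ^ δ)⁻¹)) ^ (1 / p) := by
          rw [ENNReal.ofReal_rpow_of_pos ht, div_eq_mul_inv, mul_assoc,
            ← ENNReal.ofReal_inv_of_pos (by positivity), ← ENNReal.ofReal_mul (by positivity)]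
      _ = maximalConst n δ p ^ (1 / p) * ENNReal.ofReal (K * t ^ (-(δ / p))) := by
          rw [ENNReal.mul_rpow_of_nonneg _ _ (by positivity),
            ENNReal.ofReal_rpow_of_nonneg (by positivity) (by positivity),
            Real.mul_rpow (by positivity) (by positivity), ← Real.rpow_mul hK.le,
            mul_one_div_cancel hp.ne', Real.rpow_one, ← Real.rpow_neg ht.le, ← Real.rpow_mul ht.le,
            neg_mul, mul_one_div]
      _ = _ := by rw [ENNReal.ofReal_mul hK.le]
  refine h.trans ((mul_le_mul_right h2 _).trans_eq ?_)
  ring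

/-- The constant in the pointwise estimate on John domains. -/
noncomputable def johnConst (n : ℕ) (δ p κ : ℝ) : ℝ≥0∞ :=
  (volume (Metric.ball (0 : EuclideanSpace ℝ (Fin n)) 1))⁻¹ * ENNReal.ofReal (8 / κ) ^ n *
    ((1 - ENNReal.ofReal (1 - κ / 4))⁻¹ +
      3 * volume (Metric.ball (0 : EuclideanSpace ℝ (Fin n)) 1) * 2 ^ n *
        maximalConst n δ p ^ (1 / p) *
          (1 - ENNReal.ofReal ((1 - κ / 4) ^ (δ / p - 1)))⁻¹)

lemma johnConst_ne_top {n : ℕ} {δ p κ : ℝ} (hδ : 0 < δ) (hp : δ / n < p) (hp0 : 0 < p)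
    (hpδ : p < δ) (hκ : 0 < κ) (hκ1 : κ ≤ 1) : johnConst n δ p κ ≠ ⊤ := by
  have he : 0 < δ / p - 1 := by
    rw [sub_pos, one_lt_div hp0]
    exact hpδ
  have h1 : ENNReal.ofReal (1 - κ / 4) < 1 := by
    rw [ENNReal.ofReal_lt_one]
    linarith
  have h2 : ENNReal.ofReal ((1 - κ / 4) ^ (δ / p - 1)) < 1 := by
    rw [ENNReal.ofReal_lt_one]
    exact Real.rpow_lt_one (by linarith) (by linarith) he
  refine ENNReal.mul_ne_top (ENNReal.mul_ne_top
    (ENNReal.inv_ne_top.2 (volume_unitBall_ne_zero n)) (ENNReal.pow_ne_top ENNReal.ofReal_ne_top))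
    (ENNReal.add_ne_top.2 ⟨ENNReal.inv_ne_top.2 (tsub_pos_of_lt h1).ne',
      ENNReal.mul_ne_top (ENNReal.mul_ne_top (ENNReal.mul_ne_top (ENNReal.mul_ne_top (by simp)
        (volume_unitBall_ne_top n)) (by simp)) ?_) (ENNReal.inv_ne_top.2 (tsub_pos_of_lt h2).ne')⟩)
  exact ENNReal.rpow_ne_top_of_nonneg (by positivity) (maximalConst_ne_top hδ hp)

lemma gradNorm_ne_top {n : ℕ} (Ω : Set (EuclideanSpace ℝ (Fin n)))
    (u : EuclideanSpace ℝ (Fin n) → ℝ) (x : EuclideanSpace ℝ (Fin n)) : gradNorm Ω u x ≠ ⊤ := by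
  by_cases hx : x ∈ Ω <;> simp [gradNorm, hx]

/-- Hedberg type pointwise estimate of the oscillation of `u` in a John domain. -/
lemma exists_enorm_sub_le {n : ℕ} (hn : 1 ≤ n) {α β δ p : ℝ} (hα : 0 < α) (hαβ : α ≤ β)
    (hδ : 0 < δ) (hδn : δ ≤ n) (hp0 : 0 < p) (hpδ : p < δ)
    {Ω : Set (EuclideanSpace ℝ (Fin n))} (hΩ : IsOpen Ω) (hb : IsBounded Ω)
    (hJ : IsJohnDomain n α β Ω) {u : EuclideanSpace ℝ (Fin n) → ℝ} (hu : ContDiffOn ℝ 1 u Ω) :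
    ∃ b : ℝ, ∀ x ∈ Ω, ∀ M : ℝ≥0∞, x ∉ largeAverageSet n (gradNorm Ω u) M →
      ∀ K : ℝ, 0 < K → choquetPow n δ p (gradNorm Ω u) ≤ ENNReal.ofReal (K ^ p) →
      ∀ ρ : ℝ, 0 < ρ → ‖u x - b‖ₑ ≤ johnConst n δ p (α / β) *
        (M * ENNReal.ofReal ρ + ENNReal.ofReal K * ENNReal.ofReal (ρ ^ (-(δ / p - 1)))) := by
  obtain ⟨x₀, T, hT, hball₀, hcurve⟩ := exists_john_curves hn hα hαβ hΩ hb hJ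
  have hκ : 0 < α / β := div_pos hα (hα.trans_le hαβ)
  have hκ1 : α / β ≤ 1 := (div_le_one (hα.trans_le hαβ)).2 hαβ
  have he : 0 < δ / p - 1 := by
    rw [sub_pos, one_lt_div hp0]
    exact hpδ
  unfold johnConst
  set κ := α / β
  set e := δ / p - 1 with he_def
  set ω := volume (Metric.ball (0 : EuclideanSpace ℝ (Fin n)) 1) with hω
  have hω0 : ω ≠ 0 := volume_unitBall_ne_zero n
  have hω1 : ω ≠ ⊤ := volume_unitBall_ne_top n
  set v : EuclideanSpace ℝ (Fin n) → ℝ := fun y => u (x₀ + (κ * T / 2) • y) with hv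
  have hvint : IntegrableOn v (Metric.ball 0 1) := by
    have hc : ContinuousOn v (closedBall 0 1) := by
      refine hu.continuousOn.comp (by fun_prop) fun y hy => hball₀ ?_
      rw [mem_closedBall_zero_iff] at hy
      rw [mem_ball, dist_self_add_left, norm_smul, Real.norm_of_nonneg (by positivity)]
      nlinarith [mul_pos hκ hT]
    exact (hc.integrableOn_compact (isCompact_closedBall 0 1)).mono_set ball_subset_closedBall
  refine ⟨⨍ y in Metric.ball 0 1, v y, fun x hx M hM K hK hN ρ hρ => ?_⟩
  obtain ⟨γ, hγ0, hγT, hγ, hγball⟩ := hcurve x hx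
  have hchain := lintegral_enorm_sub_john_chain_le hΩ hu hκ hκ1 hT (hγ0 ▸ hx) hγ hγball
  rw [hγ0, hγT] at hchain
  have havg : ω * ‖u x - ⨍ y in Metric.ball 0 1, v y‖ₑ ≤
      ∫⁻ y in Metric.ball (0 : EuclideanSpace ℝ (Fin n)) 1, ‖v y - u x‖ₑ := by
    have h1 : ∫ y in Metric.ball (0 : EuclideanSpace ℝ (Fin n)) 1, (v y - u x) =
        ω.toReal * ((⨍ y in Metric.ball 0 1, v y) - u x) := by
      rw [integral_sub hvint (integrableOn_const (by simpa using hω1)), setIntegral_const,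
        setAverage_eq, smul_eq_mul, smul_eq_mul, Measure.real, mul_sub, mul_inv_cancel_left₀]
      exact (ENNReal.toReal_pos hω0 hω1).ne'
    have h2 := enorm_integral_le_lintegral_enorm (μ := volume.restrict (Metric.ball 0 1))
      fun y => v y - u x
    rwa [h1, enorm_mul, enorm_sub_rev, Real.enorm_of_nonneg ENNReal.toReal_nonneg,
      ENNReal.ofReal_toReal hω1] at h2
  have hl0 : 0 < 1 - κ / 4 := by linarith
  have hl1 : 1 - κ / 4 < 1 := by linarith
  set G := ENNReal.ofReal (8 / κ) ^ n
  set A := 3 * ω * 2 ^ n * maximalConst n δ p ^ (1 / p)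
  have hsum := tsum_le_of_le_geometric_scales (M := G * M) (K := G * A * ENNReal.ofReal K)
    (a := fun k => ENNReal.ofReal ((1 - κ / 4) ^ k * T) *
        ((ENNReal.ofReal (κ * ((1 - κ / 4) ^ k * T) / 4) ^ n)⁻¹ *
          ∫⁻ y in Metric.ball x (2 * ((1 - κ / 4) ^ k * T)), gradNorm Ω u y)) hl0 hl1 hT he hρ
    (fun k => by
      have ht : 0 < (1 - κ / 4) ^ k * T := by positivity
      rw [mul_assoc]
      refine ofReal_mul_inv_mul_le hκ ht (not_lt.1 fun h => hM
        ⟨(2 * ((1 - κ / 4) ^ k * T)).toNNReal, ?_, ?_⟩)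
      · simpa using ht
      · rw [Real.coe_toNNReal _ (by positivity)]
        exact h)
    (fun k => by
      have ht : 0 < (1 - κ / 4) ^ k * T := by positivity
      refine (ofReal_mul_inv_mul_le hκ ht (setLIntegral_ball_two_mul_le hn hδ hδn hp0
        (gradNorm_ne_top Ω u) x ht hK hN)).trans_eq ?_
      have hte : ENNReal.ofReal (((1 - κ / 4) ^ k * T) ^ (-e)) =
          ENNReal.ofReal (((1 - κ / 4) ^ k * T) ^ (-(δ / p))) *
            ENNReal.ofReal ((1 - κ / 4) ^ k * T) := by
        rw [← ENNReal.ofReal_mul (by positivity)]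
        congr 1
        rw [← Real.rpow_add_one ht.ne', he_def]
        congr 1
        ring
      rw [hte]
      ring)
  calc ‖u x - ⨍ y in Metric.ball 0 1, v y‖ₑ
      = ω⁻¹ * (ω * ‖u x - ⨍ y in Metric.ball 0 1, v y‖ₑ) := by
        rw [← mul_assoc, ENNReal.inv_mul_cancel hω0 hω1, one_mul]
    _ ≤ ω⁻¹ * (G * M * ENNReal.ofReal ρ * (1 - ENNReal.ofReal (1 - κ / 4))⁻¹ +
          G * A * ENNReal.ofReal K * ENNReal.ofReal (ρ ^ (-e)) *
            (1 - ENNReal.ofReal ((1 - κ / 4) ^ e))⁻¹) :=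
        mul_le_mul_right (havg.trans (hchain.trans hsum)) _
    _ = ω⁻¹ * G * ((1 - ENNReal.ofReal (1 - κ / 4))⁻¹ * (M * ENNReal.ofReal ρ) +
          A * (1 - ENNReal.ofReal ((1 - κ / 4) ^ e))⁻¹ *
            (ENNReal.ofReal K * ENNReal.ofReal (ρ ^ (-e)))) := by ring
    _ ≤ _ := by
        rw [mul_assoc (ω⁻¹ * G)]
        refine mul_le_mul_right ?_ _
        rw [add_mul]
        gcongr
        · exact le_self_add
        · exact le_add_self

lemma choquetPow_gradNorm {n : ℕ} {δ p : ℝ} (hp : 0 < p) (Ω : Set (EuclideanSpace ℝ (Fin n)))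
    (u : EuclideanSpace ℝ (Fin n) → ℝ) :
    choquetPow n δ p (gradNorm Ω u) = choquet n δ Ω fun x => ‖fderiv ℝ u x‖ ^ p := by
  refine setLIntegral_congr_fun measurableSet_Ioi fun τ hτ => ?_
  have hτ' : (0 : ℝ) < τ := hτ
  dsimp only
  congr 1
  ext x
  by_cases hx : x ∈ Ω
  · simp only [mem_ofPred_eq, gradNorm, indicator_of_mem hx, hx, true_and]
    rw [← ofReal_norm, ENNReal.ofReal_lt_ofReal_iff_of_nonneg (by positivity),
      one_div, Real.rpow_inv_lt_iff_of_pos hτ'.le (norm_nonneg _) hp]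
  · simp [gradNorm, hx]

lemma choquet_le_of_pointwise {n : ℕ} (hn : 1 ≤ n) {δ p : ℝ} (hδ : 0 < δ) (hδn : δ ≤ n)
    (hp : 0 < p) (hpδ : p < δ) {g : EuclideanSpace ℝ (Fin n) → ℝ≥0∞} (hg : ∀ x, g x ≠ ⊤)
    {Ω : Set (EuclideanSpace ℝ (Fin n))} {f : EuclideanSpace ℝ (Fin n) → ℝ}
    {D K w : ℝ} (hD : 0 < D) (hK : 0 < K) (hw : 0 < w)
    (hω : 3 * volume (Metric.ball (0 : EuclideanSpace ℝ (Fin n)) 1) = ENNReal.ofReal w)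
    (hN : choquetPow n δ p g ≤ ENNReal.ofReal (K ^ p))
    (hf : ∀ x ∈ Ω, ∀ M : ℝ≥0∞, x ∉ largeAverageSet n g M → ∀ ρ : ℝ, 0 < ρ →
      ‖f x‖ₑ ≤ ENNReal.ofReal D *
        (M * ENNReal.ofReal ρ + ENNReal.ofReal K * ENNReal.ofReal (ρ ^ (-(δ / p - 1))))) :
    choquet n δ Ω (fun x => |f x| ^ (δ * p / (δ - p))) ≤
      maximalConst n δ p * ENNReal.ofReal (w ^ p * (2 * D) ^ (δ * p / (δ - p))) *
        ENNReal.ofReal (K ^ (δ * p / (δ - p))) := by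
  have hδp : 0 < δ - p := sub_pos.2 hpδ
  set q := δ * p / (δ - p) with hq_def
  have hq : 0 < q := by positivity
  set A := (K / w) ^ p / (2 * D * K) ^ q with hA_def
  have hA : 0 < A := by positivity
  have hsub : ∀ τ : ℝ, 0 < τ → {x ∈ Ω | τ < |f x| ^ q} ⊆
      largeAverageSet n g (3 * volume (Metric.ball (0 : EuclideanSpace ℝ (Fin n)) 1) *
        ENNReal.ofReal ((A * τ) ^ (1 / p))) := by
    rintro τ hτ x ⟨hx, hτx⟩
    by_contra hM
    set y := τ ^ (1 / q) / (2 * D * K) with hy_def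
    have hy : 0 < y := by positivity
    have hpow : (A * τ) ^ (1 / p) = K / w * y ^ (q / p) := by
      have h1 : A * τ = (K / w) ^ p * y ^ q := by
        rw [hy_def, Real.div_rpow (x := τ ^ (1 / q)) (by positivity) (by positivity),
          ← Real.rpow_mul hτ.le, one_div_mul_cancel hq.ne', Real.rpow_one]
        ring
      rw [h1, Real.mul_rpow (by positivity) (by positivity), ← Real.rpow_mul (by positivity),
        mul_one_div_cancel hp.ne', Real.rpow_one, ← Real.rpow_mul hy.le, mul_one_div]
    have hexp : q / p + -(1 / (δ / p - 1)) = 1 := by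
      have : δ - p ≠ 0 := hδp.ne'
      have h2 : δ / p - 1 = (δ - p) / p := by field_simp
      rw [h2, hq_def]
      field_simp
      ring
    have he : 0 < δ / p - 1 := by
      rw [sub_pos, one_lt_div hp]
      exact hpδ
    have h := hf x hx _ hM (y ^ (-(1 / (δ / p - 1)))) (by positivity)
    rw [hω, ← ENNReal.ofReal_mul hw.le, ← ENNReal.ofReal_mul (by positivity),
      ← ENNReal.ofReal_mul hK.le, ← ENNReal.ofReal_add (by positivity) (by positivity),
      ← ENNReal.ofReal_mul hD.le, Real.enorm_eq_ofReal_abs,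
      ENNReal.ofReal_le_ofReal_iff (by positivity), hpow, ← Real.rpow_mul hy.le, neg_mul_neg,
      one_div_mul_cancel he.ne', Real.rpow_one] at h
    have h3 : w * (K / w * y ^ (q / p)) * y ^ (-(1 / (δ / p - 1))) = K * y := by
      rw [← mul_assoc, mul_div_cancel₀ _ hw.ne', mul_assoc, ← Real.rpow_add hy, hexp,
        Real.rpow_one]
    have h4 : |f x| ≤ τ ^ (1 / q) := by
      rw [h3] at h
      refine h.trans_eq ?_
      rw [hy_def]
      field_simp
      norm_num
    refine hτx.not_ge ?_
    calc |f x| ^ q ≤ (τ ^ (1 / q)) ^ q := Real.rpow_le_rpow (abs_nonneg _) h4 hq.le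
      _ = τ := by rw [← Real.rpow_mul hτ.le, one_div_mul_cancel hq.ne', Real.rpow_one]
  calc choquet n δ Ω (fun x => |f x| ^ q)
      ≤ ∫⁻ τ in Ioi (0 : ℝ), hContent n δ (largeAverageSet n g
          (3 * volume (Metric.ball (0 : EuclideanSpace ℝ (Fin n)) 1) *
            ENNReal.ofReal ((A * τ) ^ (1 / p)))) :=
        setLIntegral_mono' measurableSet_Ioi fun τ hτ => hContent_mono (hsub τ hτ)
    _ = ENNReal.ofReal A⁻¹ * ∫⁻ τ in Ioi (0 : ℝ), hContent n δ (largeAverageSet n g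
          (3 * volume (Metric.ball (0 : EuclideanSpace ℝ (Fin n)) 1) *
            ENNReal.ofReal (τ ^ (1 / p)))) :=
        setLIntegral_Ioi_comp_mul_left hA fun τ => hContent n δ (largeAverageSet n g
          (3 * volume (Metric.ball (0 : EuclideanSpace ℝ (Fin n)) 1) *
            ENNReal.ofReal (τ ^ (1 / p))))
    _ ≤ ENNReal.ofReal A⁻¹ * (maximalConst n δ p * ENNReal.ofReal (K ^ p)) := by
        gcongr
        exact (lintegral_hContent_largeAverageSet_le hn hδ hδn hp hg).trans (by gcongr)
    _ = maximalConst n δ p * (ENNReal.ofReal A⁻¹ * ENNReal.ofReal (K ^ p)) := by ring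
    _ = _ := by
        rw [mul_assoc, ← ENNReal.ofReal_mul (by positivity), ← ENNReal.ofReal_mul (by positivity)]
        congr 2
        rw [hA_def, inv_div, Real.div_rpow hK.le hw.le, Real.mul_rpow (by positivity) hK.le]
        field_simp

/-- Corollary: Poincaré–Sobolev inequality in John domains w.r.t. Hausdorff
content. For a bounded `(α,β)`-John domain `Ω ⊆ ℝⁿ`, `0 < δ ≤ n`, `δ/n < p < δ`, there is a
constant `c = c(n, δ, p, α, β)` such that
`inf_b (∫_Ω |u-b|^{δp/(δ-p)} dH^δ_∞)^{(δ-p)/(δp)} ≤ c (∫_Ω |∇u|^p dH^δ_∞)^{1/p}`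
for all `u ∈ C¹(Ω)`. -/
theorem poincare_sobolev_john_content (n : ℕ) (hn : 2 ≤ n) (α β δ p : ℝ)
    (hα : 0 < α) (hαβ : α ≤ β) (hδ0 : 0 < δ) (hδn : δ ≤ (n : ℝ))
    (hp1 : δ / n < p) (hp2 : p < δ) :
    ∃ c : ℝ≥0, 0 < c ∧
      ∀ Ω : Set (EuclideanSpace ℝ (Fin n)), IsOpen Ω → IsConnected Ω → IsBounded Ω →
        IsJohnDomain n α β Ω →
        ∀ u : EuclideanSpace ℝ (Fin n) → ℝ, ContDiffOn ℝ 1 u Ω →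
          ⨅ b : ℝ,
              (choquet n δ Ω fun x => |u x - b| ^ (δ * p / (δ - p))) ^ ((δ - p) / (δ * p))
            ≤ c * (choquet n δ Ω fun x => ‖fderiv ℝ u x‖ ^ p) ^ (1 / p) := by
  have hn1 : 1 ≤ n := by omega
  have hp0 : 0 < p := (div_pos hδ0 (by positivity)).trans hp1
  have hδp : 0 < δ - p := sub_pos.2 hp2
  have hβ : 0 < β := hα.trans_le hαβ
  have hD := johnConst_ne_top hδ0 hp1 hp0 hp2 (div_pos hα hβ) ((div_le_one hβ).2 hαβ)
  obtain ⟨D, hD0, hPD⟩ : ∃ D : ℝ, 0 < D ∧ johnConst n δ p (α / β) ≤ ENNReal.ofReal D :=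
    ⟨(johnConst n δ p (α / β)).toReal + 1, by positivity,
      (ENNReal.le_ofReal_iff_toReal_le hD (by positivity)).2 (by linarith)⟩
  have hω3 : 3 * volume (Metric.ball (0 : EuclideanSpace ℝ (Fin n)) 1) ≠ ⊤ :=
    ENNReal.mul_ne_top (by simp) (volume_unitBall_ne_top n)
  obtain ⟨w, hw0, hw⟩ : ∃ w : ℝ, 0 < w ∧
      3 * volume (Metric.ball (0 : EuclideanSpace ℝ (Fin n)) 1) = ENNReal.ofReal w :=
    ⟨_, ENNReal.toReal_pos (mul_ne_zero (by simp) (volume_unitBall_ne_zero n)) hω3,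
      (ENNReal.ofReal_toReal hω3).symm⟩
  set q := δ * p / (δ - p) with hq_def
  have hq : 0 < q := by positivity
  have hqinv : (δ - p) / (δ * p) = q⁻¹ := (inv_div _ _).symm
  obtain ⟨c, hc⟩ : ∃ c : ℝ≥0,
      (c : ℝ≥0∞) = (maximalConst n δ p * ENNReal.ofReal (w ^ p * (2 * D) ^ q)) ^ q⁻¹ :=
    ⟨_, ENNReal.coe_toNNReal (ENNReal.rpow_ne_top_of_nonneg (by positivity)
      (ENNReal.mul_ne_top (maximalConst_ne_top hδ0 hp1) ENNReal.ofReal_ne_top))⟩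
  have hc0 : (c : ℝ≥0∞) ≠ 0 := by
    rw [hc]
    refine (ENNReal.rpow_pos (ENNReal.mul_pos (maximalConst_ne_zero n δ p)
      (ENNReal.ofReal_pos.2 (by positivity)).ne') (ENNReal.mul_ne_top
        (maximalConst_ne_top hδ0 hp1) ENNReal.ofReal_ne_top)).ne'
  refine ⟨c, by simpa [pos_iff_ne_zero] using hc0, fun Ω hΩ _ hb hJ u hu => ?_⟩
  obtain ⟨b, hub⟩ := exists_enorm_sub_le hn1 hα hαβ hδ0 hδn hp0 hp2 hΩ hb hJ hu
  refine (iInf_le _ b).trans ?_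
  rw [← choquetPow_gradNorm hp0, hqinv, mul_comm, ← ENNReal.div_le_iff_le_mul (Or.inl hc0)
    (Or.inl ENNReal.coe_ne_top)]
  refine le_of_forall_gt_imp_ge_of_dense fun K' hK' => ?_
  rcases eq_or_ne K' ⊤ with rfl | hKtop
  · exact le_top
  have hK : 0 < K'.toReal := ENNReal.toReal_pos (pos_of_gt hK').ne' hKtop
  have hN : choquetPow n δ p (gradNorm Ω u) ≤ ENNReal.ofReal (K'.toReal ^ p) := by
    rw [← ENNReal.ofReal_rpow_of_pos hK, ENNReal.ofReal_toReal hKtop]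
    calc choquetPow n δ p (gradNorm Ω u)
        = (choquetPow n δ p (gradNorm Ω u) ^ (1 / p)) ^ p := by
          rw [← ENNReal.rpow_mul, one_div_mul_cancel hp0.ne', ENNReal.rpow_one]
      _ ≤ K' ^ p := by gcongr
  rw [ENNReal.div_le_iff_le_mul (Or.inl hc0) (Or.inl ENNReal.coe_ne_top)]
  calc (choquet n δ Ω fun x => |u x - b| ^ q) ^ q⁻¹
      ≤ (maximalConst n δ p * ENNReal.ofReal (w ^ p * (2 * D) ^ q) *
          ENNReal.ofReal (K'.toReal ^ q)) ^ q⁻¹ := by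
        gcongr
        exact choquet_le_of_pointwise hn1 hδ0 hδn hp0 hp2 (gradNorm_ne_top Ω u) hD0 hK hw0 hw hN
          fun x hx M hM ρ hρ => (hub x hx M hM _ hK hN ρ hρ).trans (by gcongr)
    _ = K' * c := by
        rw [ENNReal.mul_rpow_of_nonneg _ _ (by positivity), ← hc,
          ENNReal.ofReal_rpow_of_nonneg (by positivity) (by positivity),
          ← Real.rpow_mul hK.le, mul_inv_cancel₀ hq.ne', Real.rpow_one,
          ENNReal.ofReal_toReal hKtop, mul_comm]
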